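/- Let (L,∨,∧) be a distributive lattice and a∈L. Then P_a(L) := {(x,y)∈L² : x∧y ≤ a ≤ x∨y} is closed under the operations ⊔ and ⊓ of the full twist-product, and (P_a(L),⊔,⊓,') with (x,y)' := (y,x) is a Kleene lattice: it is a distributive lattice, ' is an antitone involution, and u⊓u' ≤ w⊔w' for all u,w∈P_a(L). -/

import Mathlib

/-- `P_a(L) = {(x,y) ∈ L² : x∧y ≤ a ≤ x∨y}`. -/
def Pa {L : Type*} [Lattice L] (a : L) : Set (L × L) :=
  {p | p.1 ⊓ p.2 ≤ a ∧ a ≤ p.1 ⊔ p.2}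

/-- The join of the full twist-product: `(x,y) ⊔ (z,v) = (x∨z, y∧v)`. -/
def tsup {L : Type*} [Lattice L] (p q : L × L) : L × L :=
  (p.1 ⊔ q.1, p.2 ⊓ q.2)

/-- The meet of the full twist-product: `(x,y) ⊓ (z,v) = (x∧z, y∨v)`. -/
def tinf {L : Type*} [Lattice L] (p q : L × L) : L × L :=
  (p.1 ⊓ q.1, p.2 ⊔ q.2)

/-- The twist order on `L²`. -/
def tle {L : Type*} [Lattice L] (p q : L × L) : Prop :=
  p.1 ≤ q.1 ∧ q.2 ≤ p.2

theorem swap_mem_Pa {L : Type*} [Lattice L] {a : L} {p : L × L} (hp : p ∈ Pa a) :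
    p.swap ∈ Pa a :=
  ⟨inf_comm p.1 p.2 ▸ hp.1, sup_comm p.1 p.2 ▸ hp.2⟩

theorem tsup_mem_Pa {L : Type*} [DistribLattice L] {a : L} {p q : L × L}
    (hp : p ∈ Pa a) (hq : q ∈ Pa a) : tsup p q ∈ Pa a := by
  constructor
  · change (p.1 ⊔ q.1) ⊓ (p.2 ⊓ q.2) ≤ a
    rw [inf_sup_right]
    exact sup_le ((inf_le_inf_left _ inf_le_left).trans hp.1)
      ((inf_le_inf_left _ inf_le_right).trans hq.1)
  · change a ≤ (p.1 ⊔ q.1) ⊔ (p.2 ⊓ q.2)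
    rw [sup_inf_left]
    exact le_inf (hp.2.trans (sup_le_sup_right le_sup_left _))
      (hq.2.trans (sup_le_sup_right le_sup_right _))

theorem tinf_mem_Pa {L : Type*} [DistribLattice L] {a : L} {p q : L × L}
    (hp : p ∈ Pa a) (hq : q ∈ Pa a) : tinf p q ∈ Pa a :=
  swap_mem_Pa (tsup_mem_Pa (swap_mem_Pa hp) (swap_mem_Pa hq))

theorem tinf_tsup_left {L : Type*} [DistribLattice L] (p q r : L × L) :
    tinf p (tsup q r) = tsup (tinf p q) (tinf p r) :=
  Prod.ext (inf_sup_left _ _ _) (sup_inf_left _ _ _)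

theorem tle_swap {L : Type*} [Lattice L] {p q : L × L} (h : tle p q) :
    tle q.swap p.swap :=
  ⟨h.2, h.1⟩

theorem tinf_swap_tle_tsup_swap {L : Type*} [Lattice L] {a : L} {u w : L × L}
    (hu : u ∈ Pa a) (hw : w ∈ Pa a) : tle (tinf u u.swap) (tsup w w.swap) :=
  ⟨hu.1.trans hw.2, (swap_mem_Pa hw).1.trans (swap_mem_Pa hu).2⟩

/-- If `L` is a distributive lattice and `a ∈ L`, then `P_a(L)` is closed under
`⊔` and `⊓` of the full twist-product, and `(P_a(L), ⊔, ⊓, ')` with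
`(x,y)' := (y,x)` is a Kleene lattice. -/
theorem stmt_7 {L : Type*} [DistribLattice L] (a : L) :
    (∀ p q : L × L, p ∈ Pa a → q ∈ Pa a →
      tsup p q ∈ Pa a ∧ tinf p q ∈ Pa a) ∧
    (∀ p q r : L × L, p ∈ Pa a → q ∈ Pa a → r ∈ Pa a →
      tinf p (tsup q r) = tsup (tinf p q) (tinf p r)) ∧
    (∀ p : L × L, p ∈ Pa a → p.swap ∈ Pa a) ∧
    (∀ p q : L × L, p ∈ Pa a → q ∈ Pa a → tle p q → tle q.swap p.swap) ∧
    (∀ p : L × L, p ∈ Pa a → p.swap.swap = p) ∧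
    (∀ u w : L × L, u ∈ Pa a → w ∈ Pa a →
      tle (tinf u u.swap) (tsup w w.swap)) :=
  ⟨fun _ _ hp hq => ⟨tsup_mem_Pa hp hq, tinf_mem_Pa hp hq⟩,
    fun p q r _ _ _ => tinf_tsup_left p q r,
    fun _ hp => swap_mem_Pa hp,
    fun _ _ _ _ h => tle_swap h,
    fun p _ => p.swap_swap,
    fun _ _ hu hw => tinf_swap_tle_tsup_swap hu hw⟩
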